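/- Let C̃ be a bisymmetric (n−1)×(n−1) real matrix, c_0, c_n ∈ ℝ, c ∈ ℝ^{n−1}, č := P c. Let k, k̃ ∈ {1,…,K−1} with k ≠ k̃ and p, p̃ ∈ ℝ^{n−1}, and let s_k[p], s_{k̃}[p̃] be the mesh vectors with node values sin(πkj/K) resp. sin(πk̃j/K) and element values p sin(πk(j−1)/K) + p̌ sin(πkj/K) resp. p̃ sin(πk̃(j−1)/K) + p̃̌ sin(πk̃j/K), j = 1,…,K. Then (C s_k[p], s_{k̃}[p̃]) = 0. -/

import Mathlib

open Matrix

/-- The reversal operator on ℝ^m. -/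
def revVec (m : ℕ) (p : Fin m → ℝ) : Fin m → ℝ := fun i => p i.rev

/-- A matrix is bisymmetric if it is symmetric w.r.t. the main and
secondary diagonals. -/
def Bisym {m : ℕ} (B : Matrix (Fin m) (Fin m) ℝ) : Prop :=
  (∀ i j, B i j = B j i) ∧ (∀ i j, B i j = B j.rev i.rev)

/-- The C-bilinear form (Cv, w) of mesh vectors. -/
def Cform (n K : ℕ) (Ct : Matrix (Fin (n-1)) (Fin (n-1)) ℝ) (c0 cn : ℝ)
    (c : Fin (n-1) → ℝ) (vN : ℕ → ℝ) (vE : ℕ → Fin (n-1) → ℝ)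
    (wN : ℕ → ℝ) (wE : ℕ → Fin (n-1) → ℝ) : ℝ :=
  (∑ j ∈ Finset.Icc 1 (K-1),
      (2 * c0 * vN j + cn * (vN (j-1) + vN (j+1))
        + revVec (n-1) c ⬝ᵥ vE j + c ⬝ᵥ vE (j+1)) * wN j)
  + ∑ j ∈ Finset.Icc 1 K,
      (vN (j-1) • c + Ct.mulVec (vE j) + vN j • revVec (n-1) c) ⬝ᵥ wE j

/-- Reversal is self-adjoint for the dot product. -/
theorem revVec_dotProduct (m : ℕ) (p q : Fin m → ℝ) :
    revVec m p ⬝ᵥ q = p ⬝ᵥ revVec m q := by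
  simp only [dotProduct, revVec]
  exact Fintype.sum_equiv Fin.revPerm _ _ (fun i => by simp)

theorem revVec_revVec (m : ℕ) (p : Fin m → ℝ) : revVec m (revVec m p) = p := by
  funext i
  simp [revVec]

/-- A bisymmetric matrix commutes with reversal. -/
theorem Bisym.mulVec_revVec {m : ℕ} {B : Matrix (Fin m) (Fin m) ℝ} (hB : Bisym B)
    (p : Fin m → ℝ) : B *ᵥ revVec m p = revVec m (B *ᵥ p) := by
  funext i
  simp only [mulVec, dotProduct, revVec]
  refine Fintype.sum_equiv Fin.revPerm _ _ (fun j => ?_)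
  rw [hB.2 i j, hB.1]
  simp

/-- The lattice sine vector is an eigenvector of the discrete second difference; tested against
a sequence vanishing at both ends, with the shift moved onto the test sequence. -/
theorem sum_sin_shift_add_shift (K : ℕ) (a : ℝ) (w : ℕ → ℝ) (h0 : w 0 = 0) (hK : w K = 0) :
    ∑ i ∈ Finset.range K, (Real.sin (a * i) * w (i + 1) + Real.sin (a * (i + 1)) * w i)
      = 2 * Real.cos a * ∑ i ∈ Finset.range K, Real.sin (a * i) * w i := by
  have h := Finset.sum_range_sub (fun i : ℕ => Real.sin (a * (i - 1)) * w i) K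
  simp only [h0, hK, mul_zero, sub_zero] at h
  rw [Finset.mul_sum, ← sub_eq_zero, ← Finset.sum_sub_distrib, ← h]
  refine Finset.sum_congr rfl (fun i _ => ?_)
  push_cast
  rw [add_sub_cancel_right, mul_sub, mul_add, mul_one, Real.sin_sub, Real.sin_add]
  ring

/-- Orthogonality of lattice sine vectors. -/
theorem sum_sin_mul_sin_eq_zero (K : ℕ) (a b : ℝ) (ha : Real.sin (a * K) = 0)
    (hb : Real.sin (b * K) = 0) (hab : Real.cos a ≠ Real.cos b) :
    ∑ i ∈ Finset.range K, Real.sin (a * i) * Real.sin (b * i) = 0 := by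
  have h1 := sum_sin_shift_add_shift K a (fun i => Real.sin (b * i)) (by simp) hb
  have h2 := sum_sin_shift_add_shift K b (fun i => Real.sin (a * i)) (by simp) ha
  have h3 : ∑ i ∈ Finset.range K, Real.sin (b * i) * Real.sin (a * i)
      = ∑ i ∈ Finset.range K, Real.sin (a * i) * Real.sin (b * i) :=
    Finset.sum_congr rfl (fun i _ => mul_comm _ _)
  rw [h3] at h2
  have h4 := h1.symm.trans (Eq.trans (Finset.sum_congr rfl (fun i _ => by push_cast; ring)) h2)
  have h5 := sub_ne_zero.mpr hab
  refine (mul_eq_zero.mp ?_).resolve_left h5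
  linarith

theorem sum_Icc_one_eq_sum_range (f : ℕ → ℝ) (K : ℕ) :
    ∑ j ∈ Finset.Icc 1 K, f j = ∑ i ∈ Finset.range K, f (i + 1) := by
  induction K with
  | zero => simp
  | succ m ih => rw [Finset.sum_Icc_succ_top (by omega), ih, Finset.sum_range_succ]

/-- Distinct admissible frequencies have distinct cosines. -/
theorem cos_pi_mul_div_ne {K k l : ℕ} (hk : k ≤ K - 1) (hl : l ≤ K - 1) (hK : 2 ≤ K)
    (hkl : k ≠ l) : Real.cos (Real.pi * k / K) ≠ Real.cos (Real.pi * l / K) := by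
  have hK0 : (0 : ℝ) < K := by exact_mod_cast (by omega : 0 < K)
  have hmem : ∀ x : ℕ, x ≤ K - 1 → Real.pi * x / K ∈ Set.Icc 0 Real.pi := fun x hx => by
    have hxK : (x : ℝ) ≤ K := by exact_mod_cast (by omega : x ≤ K)
    refine ⟨by positivity, ?_⟩
    rw [div_le_iff₀ hK0]
    gcongr
  intro h
  have h' := Real.injOn_cos (hmem k hk) (hmem l hl) h
  rw [div_left_inj' hK0.ne'] at h'
  exact hkl (by exact_mod_cast mul_left_cancel₀ Real.pi_ne_zero h')

/-- The form on two generalized lattice sine vectors vanishes for frequencies `a`, `b` that are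
compatible with the boundary values and have distinct cosines. -/
theorem Cform_sin_eq_zero (n K : ℕ) (hK : 1 ≤ K)
    (Ct : Matrix (Fin (n-1)) (Fin (n-1)) ℝ) (hCt : Bisym Ct) (c0 cn : ℝ) (c : Fin (n-1) → ℝ)
    (a b : ℝ) (ha : Real.sin (a * K) = 0) (hb : Real.sin (b * K) = 0)
    (hab : Real.cos a ≠ Real.cos b) (p q : Fin (n-1) → ℝ) :
    Cform n K Ct c0 cn c
        (fun j => Real.sin (a * j))
        (fun j => Real.sin (a * ((j : ℝ) - 1)) • p + Real.sin (a * j) • revVec (n-1) p)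
        (fun j => Real.sin (b * j))
        (fun j => Real.sin (b * ((j : ℝ) - 1)) • q + Real.sin (b * j) • revVec (n-1) q)
      = 0 := by
  have hA := sum_sin_mul_sin_eq_zero K a b ha hb hab
  have hXY := sum_sin_shift_add_shift K a (fun i => Real.sin (b * i)) (by simp) hb
  rw [hA, mul_zero] at hXY
  have hB : ∑ i ∈ Finset.range K, Real.sin (a * (i + 1)) * Real.sin (b * (i + 1)) = 0 := by
    have h := Finset.sum_range_sub (fun i : ℕ => Real.sin (a * i) * Real.sin (b * i)) K
    rw [Finset.sum_sub_distrib, hA] at h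
    simpa [ha, hb] using h
  unfold Cform
  obtain ⟨m, rfl⟩ : ∃ m, K = m + 1 := ⟨K - 1, by omega⟩
  rw [sum_Icc_one_eq_sum_range, sum_Icc_one_eq_sum_range, Nat.add_sub_cancel]
  have hB' : ∑ i ∈ Finset.range m, Real.sin (a * (i + 1)) * Real.sin (b * (i + 1)) = 0 := by
    rw [Finset.sum_range_succ] at hB
    push_cast at hb
    simpa [hb] using hB
  have hnode : ∀ i ∈ Finset.range m,
      (2 * c0 * Real.sin (a * (i + 1 : ℕ))
        + cn * (Real.sin (a * (i + 1 - 1 : ℕ)) + Real.sin (a * (i + 1 + 1 : ℕ)))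
        + revVec (n-1) c ⬝ᵥ (Real.sin (a * (((i + 1 : ℕ) : ℝ) - 1)) • p
            + Real.sin (a * (i + 1 : ℕ)) • revVec (n-1) p)
        + c ⬝ᵥ (Real.sin (a * (((i + 1 + 1 : ℕ) : ℝ) - 1)) • p
            + Real.sin (a * (i + 1 + 1 : ℕ)) • revVec (n-1) p)) * Real.sin (b * (i + 1 : ℕ))
      = (2 * c0 + 2 * cn * Real.cos a + 2 * (c ⬝ᵥ p)
          + 2 * Real.cos a * (c ⬝ᵥ revVec (n-1) p))
        * (Real.sin (a * (i + 1)) * Real.sin (b * (i + 1))) := fun i _ => by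
    have hrec : Real.sin (a * (i + 1 + 1))
        = 2 * Real.cos a * Real.sin (a * (i + 1)) - Real.sin (a * i) := by
      have h1 : a * i = a * (i + 1) - a := by ring
      rw [h1, mul_add a (i + 1 : ℝ) 1, mul_one, Real.sin_sub, Real.sin_add]
      ring
    simp only [Nat.add_sub_cancel, dotProduct_add, dotProduct_smul, revVec_dotProduct,
      revVec_revVec, smul_eq_mul]
    push_cast
    simp only [add_sub_cancel_right, hrec]
    ring
  have helem : ∀ i ∈ Finset.range (m + 1),
      (Real.sin (a * (i + 1 - 1 : ℕ)) • c
        + Ct *ᵥ (Real.sin (a * (((i + 1 : ℕ) : ℝ) - 1)) • p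
            + Real.sin (a * (i + 1 : ℕ)) • revVec (n-1) p)
        + Real.sin (a * (i + 1 : ℕ)) • revVec (n-1) c)
        ⬝ᵥ (Real.sin (b * (((i + 1 : ℕ) : ℝ) - 1)) • q
            + Real.sin (b * (i + 1 : ℕ)) • revVec (n-1) q)
      = (c ⬝ᵥ q + (Ct *ᵥ p) ⬝ᵥ q) * (Real.sin (a * i) * Real.sin (b * i))
        + (c ⬝ᵥ q + (Ct *ᵥ p) ⬝ᵥ q) * (Real.sin (a * (i + 1)) * Real.sin (b * (i + 1)))
        + (c ⬝ᵥ revVec (n-1) q + (Ct *ᵥ p) ⬝ᵥ revVec (n-1) q)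
          * (Real.sin (a * i) * Real.sin (b * (i + 1 : ℕ))
            + Real.sin (a * (i + 1)) * Real.sin (b * i)) := fun i _ => by
    simp only [Nat.add_sub_cancel, mulVec_add, mulVec_smul, hCt.mulVec_revVec, add_dotProduct,
      smul_dotProduct, dotProduct_add, dotProduct_smul, revVec_dotProduct, revVec_revVec,
      smul_eq_mul]
    push_cast
    simp only [add_sub_cancel_right]
    ring
  rw [Finset.sum_congr rfl hnode, Finset.sum_congr rfl helem]
  rw [← Finset.mul_sum, hB', Finset.sum_add_distrib, Finset.sum_add_distrib, ← Finset.mul_sum,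
    ← Finset.mul_sum, ← Finset.mul_sum, hA, hB, hXY]
  simp

/-- C-orthogonality of the mesh vectors s_k[p] and s_k̃[p̃] for
k ≠ k̃. -/
theorem Cform_sk_orthogonal
    (n K : ℕ) (hn : 2 ≤ n) (hK : 2 ≤ K)
    (Ct : Matrix (Fin (n-1)) (Fin (n-1)) ℝ) (hCt : Bisym Ct)
    (c0 cn : ℝ) (c : Fin (n-1) → ℝ)
    (k kt : ℕ) (hk1 : 1 ≤ k) (hk2 : k ≤ K - 1)
    (hkt1 : 1 ≤ kt) (hkt2 : kt ≤ K - 1) (hkk : k ≠ kt)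
    (p pt : Fin (n-1) → ℝ) :
    Cform n K Ct c0 cn c
        (fun j => Real.sin (Real.pi * k * j / K))
        (fun j => Real.sin (Real.pi * k * ((j : ℝ) - 1) / K) • p
                  + Real.sin (Real.pi * k * j / K) • revVec (n-1) p)
        (fun j => Real.sin (Real.pi * kt * j / K))
        (fun j => Real.sin (Real.pi * kt * ((j : ℝ) - 1) / K) • pt
                  + Real.sin (Real.pi * kt * j / K) • revVec (n-1) pt)
      = 0 := by
  have hK0 : (K : ℝ) ≠ 0 := by exact_mod_cast (by omega : K ≠ 0)
  have hsin : ∀ x : ℕ, Real.sin (Real.pi * x / K * K) = 0 := fun x => by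
    rw [div_mul_cancel₀ _ hK0, mul_comm, Real.sin_nat_mul_pi]
  have h := Cform_sin_eq_zero n K (by omega) Ct hCt c0 cn c _ _ (hsin k) (hsin kt)
    (cos_pi_mul_div_ne hk2 hkt2 hK hkk) p pt
  simpa only [div_mul_eq_mul_div] using h
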